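/- Stability of 𝓛 under small C² bump perturbations (Lemma 2.2): Let Ω ⊂ ℝⁿ be a bounded open set, B_r(x₀) ⊂ Ω, and ψ ∈ C²(B_r(x₀)) ∩ L^∞(ℝⁿ) such that either (i) p > 2/(2−s) or Dψ(x₀) ≠ 0, or (ii) 1 < p ≤ 2/(2−s), Dψ(x₀) = 0, x₀ is an isolated critical point of ψ, and ψ ∈ C²_β(B_r(x₀)) for some β > sp/(p−1). Then for every ε > 0 and ρ̃ > 0 there exist θ̃ > 0, ρ ∈ (0, ρ̃), and η ∈ C²_c(B_{ρ/2}(x₀)) with 0 ≤ η ≤ 1 and η(x₀) = 1, such that setting ψ_θ := ψ + θη one has sup_{x ∈ B_ρ(x₀)} |𝓛ψ(x) − 𝓛ψ_θ(x)| < ε for all 0 ≤ θ < θ̃. -/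

import Mathlib

open MeasureTheory Metric Set Filter Topology Bornology
open scoped Classical

noncomputable section

/-- `n`-dimensional Euclidean space `ℝⁿ`. -/
abbrev Eucl (n : ℕ) : Type := EuclideanSpace ℝ (Fin n)

/-- Condition (1.3) on `g` together with the structural assumptions:
`g : [0,∞) → [0,∞)` continuous, strictly increasing, convex, `g 0 = 0`,
`g t → ∞`, differentiable on `(0,∞)` with `p_g ≤ t g'(t)/g(t) ≤ q_g`,
extended oddly to all of `ℝ` by `g (-t) = - g t`. -/
structure CondG (g : ℝ → ℝ) (pg qg : ℝ) : Prop where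
  one_lt : 1 < pg
  pg_le_qg : pg ≤ qg
  cont : ContinuousOn g (Ici 0)
  mono : StrictMonoOn g (Ici 0)
  convex : ConvexOn ℝ (Ici 0) g
  zero : g 0 = 0
  infty : Tendsto g atTop atTop
  diff : ∀ t : ℝ, 0 < t → DifferentiableAt ℝ g t
  lower : ∀ t : ℝ, 0 < t → pg * g t ≤ t * deriv g t
  upper : ∀ t : ℝ, 0 < t → t * deriv g t ≤ qg * g t
  odd : ∀ t : ℝ, g (-t) = - g t

/-- Assumptions on the kernel `K`: symmetry, translation invariance,
the growth condition `λ |x-y|^{-n} ≤ K x y ≤ Λ |x-y|^{-n}` (off the diagonal)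
and continuity off the diagonal. -/
structure CondK (n : ℕ) (K : Eucl n → Eucl n → ℝ) (lam Lam : ℝ) : Prop where
  lam_pos : 0 < lam
  lam_le_Lam : lam ≤ Lam
  symm : ∀ x y, K x y = K y x
  transl : ∀ x y z, K (x + z) (y + z) = K x y
  lower : ∀ x y : Eucl n, x ≠ y → lam / ‖x - y‖ ^ n ≤ K x y
  upper : ∀ x y : Eucl n, x ≠ y → K x y ≤ Lam / ‖x - y‖ ^ n
  cont : ContinuousOn (fun p : Eucl n × Eucl n => K p.1 p.2) {p | p.1 ≠ p.2}

/-- The Young function `G(t) = ∫₀ᵗ g(θ) dθ`. -/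
def GG (g : ℝ → ℝ) (t : ℝ) : ℝ := ∫ θ in (0:ℝ)..t, g θ

/-- `u ∈ L^g_s(ℝⁿ)`. -/
def MemLgs (n : ℕ) (s : ℝ) (g : ℝ → ℝ) (u : Eucl n → ℝ) : Prop :=
  Measurable u ∧
    Integrable (fun x : Eucl n => g (|u x| / (1 + ‖x‖) ^ s) / (1 + ‖x‖) ^ ((n : ℝ) + s))

/-- `u ∈ W^{s,G}(U)`. -/
def MemWsG (n : ℕ) (s : ℝ) (g : ℝ → ℝ) (u : Eucl n → ℝ) (U : Set (Eucl n)) : Prop :=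
  Measurable u ∧ IntegrableOn (fun x => GG g |u x|) U ∧
    IntegrableOn
      (fun p : Eucl n × Eucl n => GG g (|u p.1 - u p.2| / ‖p.1 - p.2‖ ^ s) / ‖p.1 - p.2‖ ^ n)
      (U ×ˢ U)

/-- `u ∈ W^{s,G}_loc(Ω)`. -/
def MemWsGloc (n : ℕ) (s : ℝ) (g : ℝ → ℝ) (u : Eucl n → ℝ) (Ω : Set (Eucl n)) : Prop :=
  ∀ Ω' : Set (Eucl n), IsOpen Ω' → IsBounded Ω' → closure Ω' ⊆ Ω →
    ∃ U : Set (Eucl n), IsOpen U ∧ closure Ω' ⊆ U ∧ MemWsG n s g u U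

/-- `η ∈ W^{s,G}₀(Ω)`. -/
def MemWsG0 (n : ℕ) (s : ℝ) (g : ℝ → ℝ) (Ω : Set (Eucl n)) (η : Eucl n → ℝ) : Prop :=
  MemWsG n s g η univ ∧ ∀ x ∉ Ω, η x = 0

/-- The nonlocal energy pairing
`∬ g((u(x)-u(y))/|x-y|^s) (η(x)-η(y)) K(x,y) |x-y|^{-s} dx dy`
(with `g` oddly extended, so that
`g((u(x)-u(y))/|x-y|^s) = g(|u(x)-u(y)|/|x-y|^s)·sgn(u(x)-u(y))`). -/
def energy (n : ℕ) (s : ℝ) (g : ℝ → ℝ) (K : Eucl n → Eucl n → ℝ) (u η : Eucl n → ℝ) : ℝ :=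
  ∫ p : Eucl n × Eucl n,
    g ((u p.1 - u p.2) / ‖p.1 - p.2‖ ^ s) * (η p.1 - η p.2) * K p.1 p.2 / ‖p.1 - p.2‖ ^ s

/-- `η ∈ C_c^∞(Ω')`. -/
def IsTest (n : ℕ) (Ω' : Set (Eucl n)) (η : Eucl n → ℝ) : Prop :=
  ContDiff ℝ (⊤ : ℕ∞) η ∧ HasCompactSupport η ∧ tsupport η ⊆ Ω'

/-- `u` is a weak supersolution of `𝓛 u = c(x) g(|u|) u/|u|` in `Ω`
(by the odd extension the right-hand side integrand is `c(x) g(u(x)) η(x)`). -/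
def WeakSupersol (n : ℕ) (s : ℝ) (g : ℝ → ℝ) (K : Eucl n → Eucl n → ℝ)
    (c : Eucl n → ℝ) (u : Eucl n → ℝ) (Ω : Set (Eucl n)) : Prop :=
  MemWsGloc n s g u Ω ∧ MemLgs n s g u ∧
    ∀ Ω' : Set (Eucl n), IsOpen Ω' → IsBounded Ω' → Ω' ⊆ Ω →
      ∀ η : Eucl n → ℝ, IsTest n Ω' η → (∀ x, 0 ≤ η x) →
        (∫ x in Ω, c x * g (u x) * η x) ≤ energy n s g K u η

/-- `u` is a weak solution of `𝓛 u = f` in `Ω`. -/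
def WeakSol (n : ℕ) (s : ℝ) (g : ℝ → ℝ) (K : Eucl n → Eucl n → ℝ)
    (f : Eucl n → ℝ) (u : Eucl n → ℝ) (Ω : Set (Eucl n)) : Prop :=
  MemWsGloc n s g u Ω ∧ MemLgs n s g u ∧
    ∀ Ω' : Set (Eucl n), IsOpen Ω' → IsBounded Ω' → Ω' ⊆ Ω →
      ∀ η : Eucl n → ℝ, IsTest n Ω' η →
        energy n s g K u η = ∫ x in Ω, f x * η x

/-- `Lpv n s g K w x L` says that the principal value
`𝓛 w (x) = p.v. ∫ g((w(x)-w(y))/|x-y|^s) K(x,y) |x-y|^{-s} dy` exists and equals `L`. -/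
def Lpv (n : ℕ) (s : ℝ) (g : ℝ → ℝ) (K : Eucl n → Eucl n → ℝ) (w : Eucl n → ℝ)
    (x : Eucl n) (L : ℝ) : Prop :=
  Tendsto (fun ε : ℝ =>
      ∫ y in (ball x ε)ᶜ, g ((w x - w y) / ‖x - y‖ ^ s) * K x y / ‖x - y‖ ^ s)
    (𝓝[>] 0) (𝓝 L)

/-- The critical set `N_ψ` of `ψ` in `D`. -/
def CritSet (n : ℕ) (ψ : Eucl n → ℝ) (D : Set (Eucl n)) : Set (Eucl n) :=
  {x ∈ D | fderiv ℝ ψ x = 0}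

/-- The class `C²_β(D)`. -/
def C2beta (n : ℕ) (ψ : Eucl n → ℝ) (D : Set (Eucl n)) (β : ℝ) : Prop :=
  ContDiffOn ℝ 2 ψ D ∧
    ∃ M : ℝ, ∀ x ∈ D,
      (min (infDist x (CritSet n ψ D)) 1) ^ (β - 1) / ‖fderiv ℝ ψ x‖ +
          ‖iteratedFDeriv ℝ 2 ψ x‖ / (infDist x (CritSet n ψ D)) ^ (β - 2) ≤ M

theorem CondG.strictMono' {g : ℝ → ℝ} {pg qg : ℝ} (hg : CondG g pg qg) : StrictMono g := by
  have hpos : ∀ t, 0 ≤ t → 0 ≤ g t := fun t ht => by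
    have := hg.mono.monotoneOn (show (0:ℝ) ∈ Ici (0:ℝ) from mem_Ici.2 le_rfl) ht ht
    rwa [hg.zero] at this
  intro a b hab
  rcases le_or_gt 0 a with ha | ha
  · exact hg.mono ha (ha.trans hab.le) hab
  · have h1 : 0 < g (-a) := by
      have := hg.mono (show (0:ℝ) ∈ Ici (0:ℝ) from mem_Ici.2 le_rfl) (show (-a) ∈ Ici (0:ℝ) by simp; linarith) (by linarith)
      rwa [hg.zero] at this
    have h2 := hg.odd a
    rcases le_or_gt 0 b with hb | hb
    · have := hpos b hb; linarith
    · have := hg.mono (show (-b) ∈ Ici (0:ℝ) by simp; linarith)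
        (show (-a) ∈ Ici (0:ℝ) by simp; linarith) (by linarith)
      have h3 := hg.odd b
      linarith

/-- Lipschitz constant of `g` on `[-R,R]`. -/
def lipC (g : ℝ → ℝ) (R : ℝ) : ℝ := g (R + 1) - g R

theorem CondG.lipC_pos {g : ℝ → ℝ} {pg qg : ℝ} (hg : CondG g pg qg) (R : ℝ) : 0 < lipC g R := by
  have := hg.strictMono' (show R < R + 1 by linarith)
  unfold lipC; linarith

theorem CondG.lip {g : ℝ → ℝ} {pg qg : ℝ} (hg : CondG g pg qg) {R a b : ℝ}
    (ha : |a| ≤ R) (hb : |b| ≤ R) : |g a - g b| ≤ lipC g R * |a - b| := by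
  have key : ∀ a b, 0 ≤ a → a ≤ b → b ≤ R → g b - g a ≤ lipC g R * (b - a) := by
    intro a b ha hab hbR
    rcases hab.eq_or_lt with rfl | hab
    · simp
    have h0R : 0 ≤ R := ha.trans (hab.le.trans hbR)
    have h2 : (g b - g a) / (b - a) ≤ (g (R + 1) - g b) / (R + 1 - b) :=
      hg.convex.slope_mono_adjacent ha (show (0:ℝ) ≤ R + 1 by linarith) hab (by linarith)
    have h3 : (g (R + 1) - g b) / (R + 1 - b) ≤ lipC g R := by
      rcases hbR.eq_or_lt with rfl | hbR
      · simp [lipC]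
      · have := hg.convex.slope_mono_adjacent (show (0:ℝ) ≤ b by linarith)
          (show (0:ℝ) ≤ R + 1 by linarith) hbR (by linarith)
        rw [div_le_div_iff₀ (by linarith) (by linarith)] at this
        rw [div_le_iff₀ (by linarith)]
        unfold lipC
        nlinarith
    have := h2.trans h3
    rwa [div_le_iff₀ (by linarith)] at this
  have main : ∀ a b, a ≤ b → |a| ≤ R → |b| ≤ R → g b - g a ≤ lipC g R * (b - a) := by
    intro a b hab ha hb
    rw [abs_le] at ha hb
    rcases le_or_gt 0 a with h | h
    · exact key a b h hab hb.2
    rcases le_or_gt 0 b with h' | h'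
    · have h1 := key 0 b le_rfl h' hb.2
      have h2 := key 0 (-a) le_rfl (by linarith) (by linarith)
      rw [hg.odd, hg.zero] at h2
      rw [hg.zero] at h1
      nlinarith
    · have := key (-b) (-a) (by linarith) (by linarith) (by linarith)
      rw [hg.odd, hg.odd] at this
      nlinarith
  rcases le_total a b with h | h
  · rw [abs_sub_comm, abs_sub_comm a b, abs_of_nonneg (by linarith [hg.strictMono'.monotone h]),
      abs_of_nonneg (by linarith)]
    exact main a b h ha hb
  · rw [abs_of_nonneg (by linarith [hg.strictMono'.monotone h]),
      abs_of_nonneg (by linarith)]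
    exact main b a h hb ha

theorem CondG.continuous' {g : ℝ → ℝ} {pg qg : ℝ} (hg : CondG g pg qg) : Continuous g := by
  rw [continuous_iff_continuousAt]
  intro a
  have hlip : LipschitzOnWith (lipC g (|a| + 1)).toNNReal g (ball a 1) := by
    apply LipschitzOnWith.of_dist_le_mul
    have : ∀ x ∈ ball a 1, |x| ≤ |a| + 1 := by
      intro x hx
      rw [mem_ball, Real.dist_eq] at hx
      have := abs_add_le (x - a) a
      simp at this; linarith
    intro x hx y hy
    rw [Real.coe_toNNReal _ (hg.lipC_pos _).le]
    exact hg.lip (this x hx) (this y hy)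
  exact hlip.continuousOn.continuousAt (ball_mem_nhds a one_pos)

theorem CondG.abs' {g : ℝ → ℝ} {pg qg : ℝ} (hg : CondG g pg qg) {a R : ℝ} (h : |a| ≤ R) :
    |g a| ≤ g R := by
  rw [abs_le] at h ⊢
  have h1 := hg.strictMono'.monotone h.1
  have h2 := hg.strictMono'.monotone h.2
  rw [hg.odd] at h1
  exact ⟨h1, h2⟩

/-- Radial dominating profile. -/
def prof (n : ℕ) (s δ t : ℝ) : ℝ :=
  if t < δ then t ^ (2 - 2 * s - n) else t ^ (-(n:ℝ) - s)

theorem prof_nonneg (n : ℕ) (s δ : ℝ) {t : ℝ} (ht : 0 ≤ t) : 0 ≤ prof n s δ t := by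
  unfold prof; split_ifs <;> positivity

theorem integrable_prof (n : ℕ) (hn : 1 ≤ n) (s : ℝ) (hs0 : 0 < s) (hs1 : s < 1) (δ : ℝ)
    (hδ : 0 < δ) : Integrable (fun z : Eucl n => prof n s δ ‖z‖) := by
  have : Nonempty (Fin n) := ⟨⟨0, hn⟩⟩
  have : Nontrivial (Eucl n) := inferInstance
  rw [integrable_fun_norm_addHaar volume (f := prof n s δ)]
  rw [finrank_euclideanSpace_fin, ← Ioo_union_Ici_eq_Ioi hδ]
  have hpow : ∀ t : ℝ, 0 < t → ∀ e : ℝ, t ^ (n - 1) * t ^ e = t ^ ((n:ℝ) - 1 + e) := by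
    intro t ht e
    rw [Real.rpow_add ht]
    congr 1
    rw [← Real.rpow_natCast, Nat.cast_sub hn]; simp
  refine IntegrableOn.union ?_ ?_
  · refine IntegrableOn.congr_fun (f := fun t : ℝ => t ^ (1 - 2 * s)) ?_ ?_ measurableSet_Ioo
    · rw [intervalIntegral.integrableOn_Ioo_rpow_iff hδ]; linarith
    · intro t ht
      simp only [prof, if_pos ht.2, smul_eq_mul]
      rw [hpow t ht.1]; congr 1; ring
  · refine IntegrableOn.congr_fun (f := fun t : ℝ => t ^ (-1 - s)) ?_ ?_ measurableSet_Ici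
    · rw [integrableOn_Ici_iff_integrableOn_Ioi]
      exact integrableOn_Ioi_rpow_of_lt (by linarith) hδ
    · intro t ht
      simp only [prof, if_neg (not_lt.2 (mem_Ici.1 ht)), smul_eq_mul]
      rw [hpow t (hδ.trans_le ht)]; congr 1; ring

theorem c2_bounds (n : ℕ) (u : Eucl n → ℝ) (x₀ : Eucl n) (r : ℝ) (hr : 0 < r)
    (hu : ContDiffOn ℝ 2 u (ball x₀ r)) :
    ∃ C : ℝ, 0 ≤ C ∧ ∀ x ∈ ball x₀ (r / 4), ∀ z : Eucl n, ‖z‖ < r / 4 →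
      |u x - u (x + z)| ≤ C * ‖z‖ ∧ |u (x + z) + u (x - z) - 2 * u x| ≤ C * ‖z‖ ^ 2 := by
  have hsub : closedBall x₀ (r / 2) ⊆ ball x₀ r := closedBall_subset_ball (by linarith)
  obtain ⟨K1, h1⟩ := (hu.mono hsub).exists_lipschitzOnWith (by norm_num)
    (convex_closedBall _ _) (isCompact_closedBall _ _)
  obtain ⟨K2, h2⟩ := ((hu.fderiv_of_isOpen isOpen_ball (m := 1) (by norm_num)).mono
    hsub).exists_lipschitzOnWith (by norm_num) (convex_closedBall _ _) (isCompact_closedBall _ _)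
  refine ⟨max K1 (2 * K2), by positivity, ?_⟩
  intro x hx z hz
  have hmem : ∀ v : Eucl n, ‖v‖ ≤ ‖z‖ → x + v ∈ closedBall x₀ (r / 2) := by
    intro v hv
    rw [mem_ball, dist_eq_norm] at hx
    rw [mem_closedBall, dist_eq_norm]
    have := norm_add_le (x - x₀) v
    rw [show x + v - x₀ = x - x₀ + v by abel]
    linarith
  constructor
  · have := h1.dist_le_mul x (by simpa using hmem 0 (by simp)) (x + z) (hmem z le_rfl)
    rw [Real.dist_eq, dist_eq_norm] at this
    refine this.trans ?_
    rw [show x - (x + z) = - z by abel, norm_neg]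
    gcongr
    exact le_max_left _ _
  · have hd : ∀ v ∈ closedBall (0 : Eucl n) ‖z‖, HasFDerivWithinAt
        (fun v => u (x + v) + u (x - v)) (fderiv ℝ u (x + v) - fderiv ℝ u (x - v))
        (closedBall (0 : Eucl n) ‖z‖) v := by
      intro v hv
      rw [mem_closedBall_zero_iff] at hv
      have e1 : HasFDerivAt u (fderiv ℝ u (x + v)) (x + v) :=
        ((hu.contDiffAt (isOpen_ball.mem_nhds (hsub (hmem v hv)))).differentiableAt
          (by norm_num)).hasFDerivAt
      have e2 : HasFDerivAt u (fderiv ℝ u (x - v)) (x - v) := by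
        have hm := hsub (hmem (-v) (by simpa using hv))
        rw [← sub_eq_add_neg] at hm
        exact ((hu.contDiffAt (isOpen_ball.mem_nhds hm)).differentiableAt
          (by norm_num)).hasFDerivAt
      have f1 := e1.comp v ((hasFDerivAt_id v).const_add x)
      have f2 := e2.comp v ((hasFDerivAt_id v).const_sub x)
      have f3 := (f1.add f2).hasFDerivWithinAt (s := closedBall (0 : Eucl n) ‖z‖)
      have he : fderiv ℝ u (x + v) - fderiv ℝ u (x - v) =
          fderiv ℝ u (x + v) ∘SL ContinuousLinearMap.id ℝ (Eucl n) +
          fderiv ℝ u (x - v) ∘SL (-ContinuousLinearMap.id ℝ (Eucl n)) := by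
        ext w; simp [sub_eq_add_neg]
      rw [he]
      exact f3
    have hb : ∀ v ∈ closedBall (0 : Eucl n) ‖z‖,
        ‖fderiv ℝ u (x + v) - fderiv ℝ u (x - v)‖ ≤ 2 * K2 * ‖z‖ := by
      intro v hv
      rw [mem_closedBall_zero_iff] at hv
      have hm := hmem (-v) (by simpa using hv)
      rw [← sub_eq_add_neg] at hm
      have := h2.dist_le_mul _ (hmem v hv) _ hm
      rw [dist_eq_norm, dist_eq_norm, show x + v - (x - v) = (2:ℝ) • v by rw [two_smul]; abel,
        norm_smul] at this
      refine this.trans ?_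
      simp only [Real.norm_ofNat]
      nlinarith [K2.coe_nonneg]
    have := Convex.norm_image_sub_le_of_norm_hasFDerivWithin_le hd hb (convex_closedBall _ _)
      (show (0 : Eucl n) ∈ closedBall (0 : Eucl n) ‖z‖ by simp)
      (show z ∈ closedBall (0 : Eucl n) ‖z‖ by simp)
    simp only [add_zero, sub_zero, Real.norm_eq_abs] at this
    rw [← two_mul] at this
    refine this.trans ?_
    rw [mul_assoc, ← sq]
    gcongr
    exact le_max_right _ _

/-- The integrand of `𝓛 w (x)` in the variable `z = y - x`. -/
def Fz (n : ℕ) (s : ℝ) (g : ℝ → ℝ) (K : Eucl n → Eucl n → ℝ) (w : Eucl n → ℝ)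
    (x z : Eucl n) : ℝ := g ((w x - w (x + z)) / ‖z‖ ^ s) * K 0 z / ‖z‖ ^ s

/-- The symmetrized integrand. -/
def Hz (n : ℕ) (s : ℝ) (g : ℝ → ℝ) (K : Eucl n → Eucl n → ℝ) (w : Eucl n → ℝ)
    (x z : Eucl n) : ℝ := (Fz n s g K w x z + Fz n s g K w x (-z)) / 2

theorem CondK.even {n : ℕ} {K : Eucl n → Eucl n → ℝ} {lam Lam : ℝ} (hK : CondK n K lam Lam)
    (z : Eucl n) : K 0 (-z) = K 0 z := by
  have := hK.transl 0 (-z) z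
  rw [← this, hK.symm]; simp

theorem CondK.shift {n : ℕ} {K : Eucl n → Eucl n → ℝ} {lam Lam : ℝ} (hK : CondK n K lam Lam)
    (x z : Eucl n) : K x (x + z) = K 0 z := by
  have := hK.transl 0 z x
  rw [← this, zero_add, add_comm]

theorem CondK.nonneg' {n : ℕ} {K : Eucl n → Eucl n → ℝ} {lam Lam : ℝ} (hK : CondK n K lam Lam)
    {z : Eucl n} (hz : z ≠ 0) : 0 < K 0 z := by
  have := hK.lower 0 z hz.symm
  have h1 := hK.lam_pos
  have h2 : 0 < ‖(0 : Eucl n) - z‖ := by simpa using hz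
  exact lt_of_lt_of_le (by positivity) this

theorem CondK.upper' {n : ℕ} {K : Eucl n → Eucl n → ℝ} {lam Lam : ℝ} (hK : CondK n K lam Lam)
    {z : Eucl n} (hz : z ≠ 0) : K 0 z ≤ Lam / ‖z‖ ^ n := by
  simpa using hK.upper 0 z hz.symm

theorem CondK.meas {n : ℕ} {K : Eucl n → Eucl n → ℝ} {lam Lam : ℝ} (hK : CondK n K lam Lam) :
    Measurable (fun z => K 0 z) := by
  apply measurable_of_continuousOn_compl_singleton (0 : Eucl n)
  exact hK.cont.comp (f := fun z : Eucl n => ((0 : Eucl n), z)) (by fun_prop)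
    (fun z hz => by simpa [eq_comm] using hz)

theorem Fz_zero {n : ℕ} {s : ℝ} (hs0 : 0 < s) (g : ℝ → ℝ) (K : Eucl n → Eucl n → ℝ)
    (w : Eucl n → ℝ) (x : Eucl n) : Fz n s g K w x 0 = 0 := by
  simp [Fz, Real.zero_rpow hs0.ne']

theorem Hz_zero {n : ℕ} {s : ℝ} (hs0 : 0 < s) (g : ℝ → ℝ) (K : Eucl n → Eucl n → ℝ)
    (w : Eucl n → ℝ) (x : Eucl n) : Hz n s g K w x 0 = 0 := by
  simp [Hz, Fz_zero hs0]

theorem Fz_far {n : ℕ} {s : ℝ} (hs0 : 0 < s) {g : ℝ → ℝ} {pg qg : ℝ} (hg : CondG g pg qg)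
    {K : Eucl n → Eucl n → ℝ} {lam Lam : ℝ} (hK : CondK n K lam Lam) {w : Eucl n → ℝ} {M : ℝ}
    (hw : ∀ x, |w x| ≤ M) {δ : ℝ} (hδ : 0 < δ) (x : Eucl n) {z : Eucl n} (hz : δ ≤ ‖z‖) :
    |Fz n s g K w x z| ≤ g (2 * M / δ ^ s) * Lam * ‖z‖ ^ (-(n:ℝ) - s) := by
  have hz0 : 0 < ‖z‖ := hδ.trans_le hz
  have hz1 : z ≠ 0 := norm_pos_iff.1 hz0
  have h1 : |(w x - w (x + z)) / ‖z‖ ^ s| ≤ 2 * M / δ ^ s := by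
    rw [abs_div, abs_of_pos (Real.rpow_pos_of_pos hz0 s)]
    have := abs_sub (w x) (w (x + z))
    have h2 := hw x
    have h3 := hw (x + z)
    have h4 := abs_nonneg (w x)
    gcongr
    · linarith
    · linarith
  have h2 := hg.abs' h1
  have h3 := hK.upper' hz1
  have h4 := hK.nonneg' hz1
  have h5 : 0 ≤ g (2 * M / δ ^ s) := (abs_nonneg _).trans h2
  unfold Fz
  rw [abs_div, abs_mul, abs_of_pos h4, abs_of_pos (Real.rpow_pos_of_pos hz0 s)]
  calc _ ≤ g (2 * M / δ ^ s) * (Lam / ‖z‖ ^ n) / ‖z‖ ^ s := by gcongr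
    _ = _ := by
      rw [Real.rpow_sub hz0, Real.rpow_neg hz0.le, Real.rpow_natCast]
      field_simp

theorem Hz_near {n : ℕ} {s : ℝ} (hs1 : s < 1) {g : ℝ → ℝ} {pg qg : ℝ} (hg : CondG g pg qg)
    {K : Eucl n → Eucl n → ℝ} {lam Lam : ℝ} (hK : CondK n K lam Lam) {w : Eucl n → ℝ} {C : ℝ}
    (hC : 0 ≤ C) {δ : ℝ} {x z : Eucl n} (hz : ‖z‖ < δ) (hz1 : z ≠ 0)
    (h1 : |w x - w (x + z)| ≤ C * ‖z‖) (h2 : |w x - w (x - z)| ≤ C * ‖z‖)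
    (h3 : |w (x + z) + w (x - z) - 2 * w x| ≤ C * ‖z‖ ^ 2) :
    |Hz n s g K w x z| ≤ lipC g (C * δ ^ (1 - s)) * C * Lam * ‖z‖ ^ (2 - 2 * s - n) := by
  have hz0 : 0 < ‖z‖ := norm_pos_iff.2 hz1
  have ht := Real.rpow_pos_of_pos hz0 s
  have aux : ∀ a, |a| ≤ C * ‖z‖ → |a / ‖z‖ ^ s| ≤ C * δ ^ (1 - s) := by
    intro a ha
    rw [abs_div, abs_of_pos ht, div_le_iff₀ ht]
    refine ha.trans ?_
    rw [mul_assoc]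
    gcongr
    calc ‖z‖ = ‖z‖ ^ (1 - s) * ‖z‖ ^ s := by rw [← Real.rpow_add hz0]; simp
      _ ≤ _ := by
        gcongr
  have hb : |-((w x - w (x - z)) / ‖z‖ ^ s)| ≤ C * δ ^ (1 - s) := by
    rw [abs_neg]; exact aux _ h2
  have h4 := hg.lip (aux _ h1) hb
  rw [hg.odd] at h4
  have h5 := hK.upper' hz1
  have h6 := hK.nonneg' hz1
  have hL := hg.lipC_pos (C * δ ^ (1 - s))
  have h7 : |(w x - w (x + z)) / ‖z‖ ^ s - -((w x - w (x - z)) / ‖z‖ ^ s)|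
      ≤ C * ‖z‖ ^ 2 / ‖z‖ ^ s := by
    rw [show (w x - w (x + z)) / ‖z‖ ^ s - -((w x - w (x - z)) / ‖z‖ ^ s) =
      -((w (x + z) + w (x - z) - 2 * w x) / ‖z‖ ^ s) by ring, abs_neg, abs_div, abs_of_pos ht]
    gcongr
  have hLam : 0 < Lam := hK.lam_pos.trans_le hK.lam_le_Lam
  have heq : Hz n s g K w x z = (g ((w x - w (x + z)) / ‖z‖ ^ s) -
      -g ((w x - w (x - z)) / ‖z‖ ^ s)) * K 0 z / ‖z‖ ^ s / 2 := by
    unfold Hz Fz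
    rw [hK.even, norm_neg, ← sub_eq_add_neg]
    ring
  rw [heq, abs_div, abs_div, abs_mul, abs_of_pos h6, abs_of_pos ht, abs_two]
  calc _ ≤ (lipC g (C * δ ^ (1 - s)) * (C * ‖z‖ ^ 2 / ‖z‖ ^ s)) * (Lam / ‖z‖ ^ n) / ‖z‖ ^ s / 2 := by
        gcongr
        exact h4.trans (by gcongr)
    _ ≤ (lipC g (C * δ ^ (1 - s)) * (C * ‖z‖ ^ 2 / ‖z‖ ^ s)) * (Lam / ‖z‖ ^ n) / ‖z‖ ^ s :=
        half_le_self (by positivity)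
    _ = _ := by
      rw [Real.rpow_sub hz0, Real.rpow_sub hz0, Real.rpow_natCast,
        show (2:ℝ) * s = s + s by ring, Real.rpow_add hz0, Real.rpow_two]
      field_simp

theorem Hz_bound {n : ℕ} {s : ℝ} (hs0 : 0 < s) (hs1 : s < 1) {g : ℝ → ℝ} {pg qg : ℝ}
    (hg : CondG g pg qg)
    {K : Eucl n → Eucl n → ℝ} {lam Lam : ℝ} (hK : CondK n K lam Lam) {w : Eucl n → ℝ} {C : ℝ}
    (hC : 0 ≤ C) {M : ℝ} (hw : ∀ x, |w x| ≤ M) {δ : ℝ} (hδ : 0 < δ) {x : Eucl n}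
    (h : ∀ z : Eucl n, ‖z‖ < δ →
      |w x - w (x + z)| ≤ C * ‖z‖ ∧ |w (x + z) + w (x - z) - 2 * w x| ≤ C * ‖z‖ ^ 2)
    (z : Eucl n) :
    |Hz n s g K w x z| ≤ (lipC g (C * δ ^ (1 - s)) * C + g (2 * M / δ ^ s)) * Lam
      * prof n s δ ‖z‖ := by
  have hLam : 0 < Lam := hK.lam_pos.trans_le hK.lam_le_Lam
  have hL := hg.lipC_pos (C * δ ^ (1 - s))
  have hM : 0 ≤ M := (abs_nonneg _).trans (hw 0)
  have hgM : 0 ≤ g (2 * M / δ ^ s) := by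
    rw [← hg.zero]; exact hg.strictMono'.monotone (by positivity)
  rcases eq_or_ne z 0 with rfl | hz1
  · rw [Hz_zero hs0, abs_zero]
    have := prof_nonneg n s δ (norm_nonneg (0 : Eucl n))
    positivity
  rcases lt_or_ge ‖z‖ δ with hz | hz
  · have h2 := (h (-z) (by simpa using hz)).1
    rw [norm_neg, ← sub_eq_add_neg] at h2
    refine (Hz_near hs1 hg hK hC hz hz1 (h z hz).1 h2 (h z hz).2).trans ?_
    rw [prof, if_pos hz]
    gcongr
    linarith
  · have a1 := Fz_far hs0 hg hK hw hδ x hz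
    have a2 := Fz_far hs0 hg hK hw hδ x (z := -z) (by simpa using hz)
    rw [norm_neg] at a2
    rw [prof, if_neg (not_lt.2 hz)]
    calc |Hz n s g K w x z| ≤ g (2 * M / δ ^ s) * Lam * ‖z‖ ^ (-(n:ℝ) - s) := by
          unfold Hz
          rw [abs_div, abs_two]
          have := abs_add_le (Fz n s g K w x z) (Fz n s g K w x (-z))
          linarith
      _ ≤ _ := by
          gcongr
          have : 0 ≤ lipC g (C * δ ^ (1 - s)) * C := by positivity
          linarith

theorem Fz_meas {n : ℕ} {s : ℝ} {g : ℝ → ℝ} {pg qg : ℝ} (hg : CondG g pg qg)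
    {K : Eucl n → Eucl n → ℝ} {lam Lam : ℝ} (hK : CondK n K lam Lam) {w : Eucl n → ℝ}
    (hw : AEMeasurable w) (x : Eucl n) : AEMeasurable (fun z => Fz n s g K w x z) := by
  have h1 : AEMeasurable (fun z => w (x + z)) :=
    hw.comp_quasiMeasurePreserving (measurePreserving_add_left volume x).quasiMeasurePreserving
  have h2 : AEMeasurable (fun z => K 0 z) := hK.meas.aemeasurable
  have h3 : Measurable g := hg.continuous'.measurable
  have h4 : Measurable (fun z : Eucl n => ‖z‖ ^ s) := by fun_prop
  unfold Fz
  exact ((h3.comp_aemeasurable ((h1.const_sub _).div h4.aemeasurable)).mul h2).div h4.aemeasurable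

theorem Hz_meas {n : ℕ} {s : ℝ} {g : ℝ → ℝ} {pg qg : ℝ} (hg : CondG g pg qg)
    {K : Eucl n → Eucl n → ℝ} {lam Lam : ℝ} (hK : CondK n K lam Lam) {w : Eucl n → ℝ}
    (hw : AEMeasurable w) (x : Eucl n) : AEMeasurable (fun z => Hz n s g K w x z) := by
  have h1 := Fz_meas (s := s) hg hK hw x
  have h2 : AEMeasurable (fun z => Fz n s g K w x (-z)) :=
    h1.comp_quasiMeasurePreserving (Measure.measurePreserving_neg volume).quasiMeasurePreserving
  exact (h1.add h2).div_const 2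

theorem Lpv_of_meas {n : ℕ} (hn : 1 ≤ n) {s : ℝ} (hs0 : 0 < s) (hs1 : s < 1) {g : ℝ → ℝ}
    {pg qg : ℝ} (hg : CondG g pg qg)
    {K : Eucl n → Eucl n → ℝ} {lam Lam : ℝ} (hK : CondK n K lam Lam) {w : Eucl n → ℝ}
    (hw : AEMeasurable w) {M : ℝ} (hM : ∀ x, |w x| ≤ M) (x : Eucl n)
    (hH : Integrable (fun z => Hz n s g K w x z)) :
    Lpv n s g K w x (∫ z, Hz n s g K w x z) := by
  have key : ∀ ε : ℝ, 0 < ε →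
      ∫ y in (ball x ε)ᶜ, g ((w x - w y) / ‖x - y‖ ^ s) * K x y / ‖x - y‖ ^ s =
      ∫ z, indicator (ball (0 : Eucl n) ε)ᶜ (fun z => Hz n s g K w x z) z := by
    intro ε hε
    rw [integral_indicator measurableSet_ball.compl]
    have e1 := (measurePreserving_add_left (volume : Measure (Eucl n)) x).setIntegral_preimage_emb
      (measurableEmbedding_addLeft x)
      (fun y => g ((w x - w y) / ‖x - y‖ ^ s) * K x y / ‖x - y‖ ^ s) (ball x ε)ᶜ
    have e2 : (fun z => x + z) ⁻¹' (ball x ε)ᶜ = (ball (0 : Eucl n) ε)ᶜ := by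
      ext z; simp [dist_eq_norm]
    have e3 : ∀ z, g ((w x - w (x + z)) / ‖x - (x + z)‖ ^ s) * K x (x + z) / ‖x - (x + z)‖ ^ s
        = Fz n s g K w x z := by
      intro z
      rw [hK.shift, show x - (x + z) = -z by abel, norm_neg, Fz]
    simp only [e2, e3] at e1
    rw [← e1]
    have hI : IntegrableOn (fun z => Fz n s g K w x z) (ball (0 : Eucl n) ε)ᶜ := by
      refine Integrable.mono' (((integrable_prof n hn s hs0 hs1 ε hε).const_mul
        (g (2 * M / ε ^ s) * Lam)).integrableOn (s := (ball (0 : Eucl n) ε)ᶜ))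
        (Fz_meas hg hK hw x).aestronglyMeasurable.restrict ?_
      refine ae_restrict_of_forall_mem measurableSet_ball.compl ?_
      intro z hz
      have hz' : ε ≤ ‖z‖ := by simpa using hz
      rw [prof, if_neg (not_lt.2 hz'), Real.norm_eq_abs]
      exact Fz_far hs0 hg hK hM hε x hz'
    have mp := Measure.measurePreserving_neg (volume : Measure (Eucl n))
    have me : MeasurableEmbedding (fun z : Eucl n => -z) := (MeasurableEquiv.neg _).measurableEmbedding
    have e4 : (fun z => -z) ⁻¹' (ball (0 : Eucl n) ε)ᶜ = (ball (0 : Eucl n) ε)ᶜ := by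
      ext z; simp
    have e5 := mp.setIntegral_preimage_emb me (fun z => Fz n s g K w x z) (ball (0 : Eucl n) ε)ᶜ
    have hI2 := (mp.integrableOn_comp_preimage me (f := fun z => Fz n s g K w x z)
      (s := (ball (0 : Eucl n) ε)ᶜ)).2 hI
    simp only [e4] at e5 hI2
    have hI2 : IntegrableOn (fun z => Fz n s g K w x (-z)) (ball (0 : Eucl n) ε)ᶜ := hI2
    unfold Hz
    rw [integral_div, integral_add hI hI2, e5]
    ring
  unfold Lpv
  refine Tendsto.congr' (f₁ := fun ε => ∫ z, indicator (ball (0 : Eucl n) ε)ᶜ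
    (fun z => Hz n s g K w x z) z) ?_ ?_
  · filter_upwards [self_mem_nhdsWithin] with ε hε
    exact (key ε hε).symm
  · refine tendsto_integral_filter_of_dominated_convergence (fun z => ‖Hz n s g K w x z‖) ?_ ?_
      hH.norm ?_
    · exact Eventually.of_forall fun ε => hH.aestronglyMeasurable.indicator measurableSet_ball.compl
    · exact Eventually.of_forall fun ε => Eventually.of_forall fun z =>
        norm_indicator_le_norm_self _ _
    · refine Eventually.of_forall fun z => ?_
      rcases eq_or_ne z 0 with rfl | hz
      · simp only [Hz_zero hs0]
        refine tendsto_const_nhds.congr fun ε => ?_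
        by_cases h : (0 : Eucl n) ∈ (ball (0 : Eucl n) ε)ᶜ
        · rw [indicator_of_mem h, Hz_zero hs0]
        · rw [indicator_of_notMem h]
      · refine tendsto_const_nhds.congr' ?_
        have : ∀ᶠ ε in 𝓝[>] (0:ℝ), ε < ‖z‖ :=
          mem_nhdsWithin_of_mem_nhds (Iio_mem_nhds (norm_pos_iff.2 hz))
        filter_upwards [this] with ε hε
        rw [indicator_of_mem]
        simpa using hε.le

theorem Lpv_of_not_meas {n : ℕ} {s : ℝ} {g : ℝ → ℝ}
    {pg qg : ℝ} (hg : CondG g pg qg)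
    {K : Eucl n → Eucl n → ℝ} {lam Lam : ℝ} (hK : CondK n K lam Lam) {w : Eucl n → ℝ}
    (hw : ¬ AEMeasurable w) {x₀ : Eucl n} {r : ℝ} (hc : ContinuousOn w (ball x₀ r))
    {x : Eucl n} (hx : x ∈ ball x₀ r) : Lpv n s g K w x 0 := by
  unfold Lpv
  obtain ⟨δ, hδ, hsub⟩ := Metric.isOpen_iff.1 isOpen_ball x hx
  refine tendsto_const_nhds.congr' ?_
  have : ∀ᶠ ε in 𝓝[>] (0:ℝ), ε < δ := mem_nhdsWithin_of_mem_nhds (Iio_mem_nhds hδ)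
  filter_upwards [this, self_mem_nhdsWithin] with ε hε hε0
  have hε0 : 0 < ε := hε0
  symm
  apply integral_undef
  intro hint
  apply hw
  have h1 := hint.aestronglyMeasurable.aemeasurable
  have hKm : Measurable (fun y => K x y) := by
    have : (fun y => K x y) = (fun z => K 0 z) ∘ (fun y => y - x) := by
      ext y
      simp [← hK.shift x (y - x)]
    rw [this]
    exact hK.meas.comp (by fun_prop)
  have hnm : Measurable (fun y : Eucl n => ‖x - y‖ ^ s) := by fun_prop
  have h2 : AEMeasurable w (volume.restrict (ball x ε)ᶜ) := by
    have h3 : AEMeasurable (fun y => g ((w x - w y) / ‖x - y‖ ^ s))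
        (volume.restrict (ball x ε)ᶜ) := by
      refine ((h1.mul hnm.aemeasurable).div hKm.aemeasurable).congr ?_
      refine ae_restrict_of_forall_mem measurableSet_ball.compl ?_
      intro y hy
      have hy' : ε ≤ ‖x - y‖ := by
        rw [← dist_eq_norm, dist_comm]; simpa using hy
      have hp := Real.rpow_pos_of_pos (hε0.trans_le hy') s
      have hk : 0 < K x y := by
        have := hK.nonneg' (z := y - x) (by
          intro h; rw [← norm_neg, neg_sub, h, norm_zero] at hy'; linarith)
        rwa [← hK.shift x, add_sub_cancel] at this
      simp only [Pi.mul_apply, Pi.div_apply]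
      field_simp
    have hemb : MeasurableEmbedding g :=
      hg.continuous'.measurableEmbedding hg.strictMono'.injective
    have h4 : AEMeasurable (fun y => (w x - w y) / ‖x - y‖ ^ s)
        (volume.restrict (ball x ε)ᶜ) := hemb.aemeasurable_comp_iff.1 h3
    refine ((h4.mul hnm.aemeasurable).const_sub (w x)).congr ?_
    refine ae_restrict_of_forall_mem measurableSet_ball.compl ?_
    intro y hy
    have hy' : ε ≤ ‖x - y‖ := by
      rw [← dist_eq_norm, dist_comm]; simpa using hy
    have hp := Real.rpow_pos_of_pos (hε0.trans_le hy') s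
    simp only [Pi.mul_apply]
    field_simp
    ring
  have h5 : AEMeasurable w (volume.restrict (ball x ε)) :=
    (hc.mono ((ball_subset_ball hε.le).trans hsub)).aemeasurable measurableSet_ball
  have h6 := aemeasurable_union_iff.2 ⟨h5, h2⟩
  rwa [union_compl_self, Measure.restrict_univ] at h6

/-- Pointwise Lipschitz factor for the difference. -/
def Cz (n : ℕ) (s : ℝ) (g : ℝ → ℝ) (Lam M : ℝ) (z : Eucl n) : ℝ :=
  lipC g (2 * M / ‖z‖ ^ s) * (1 / ‖z‖ ^ s) * (Lam / ‖z‖ ^ n) / ‖z‖ ^ s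

theorem Fz_diff {n : ℕ} {s : ℝ} {g : ℝ → ℝ} {pg qg : ℝ} (hg : CondG g pg qg)
    {K : Eucl n → Eucl n → ℝ} {lam Lam : ℝ} (hK : CondK n K lam Lam) {v w : Eucl n → ℝ} {M : ℝ}
    (hv : ∀ x, |v x| ≤ M) (hw : ∀ x, |w x| ≤ M) {θ : ℝ} (x : Eucl n) {z : Eucl n} (hz1 : z ≠ 0)
    (hd : |(v x - v (x + z)) - (w x - w (x + z))| ≤ θ) :
    |Fz n s g K v x z - Fz n s g K w x z| ≤ θ * Cz n s g Lam M z := by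
  have hz0 : 0 < ‖z‖ := norm_pos_iff.2 hz1
  have ht := Real.rpow_pos_of_pos hz0 s
  have aux : ∀ u : Eucl n → ℝ, (∀ x, |u x| ≤ M) →
      |(u x - u (x + z)) / ‖z‖ ^ s| ≤ 2 * M / ‖z‖ ^ s := by
    intro u hu
    rw [abs_div, abs_of_pos ht]
    have := abs_sub (u x) (u (x + z))
    have h2 := hu x
    have h3 := hu (x + z)
    gcongr
    linarith
  have h4 := hg.lip (aux v hv) (aux w hw)
  have h5 := hK.upper' hz1
  have h6 := hK.nonneg' hz1
  have hL := hg.lipC_pos (2 * M / ‖z‖ ^ s)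
  have h7 : |(v x - v (x + z)) / ‖z‖ ^ s - (w x - w (x + z)) / ‖z‖ ^ s| ≤ θ / ‖z‖ ^ s := by
    rw [← sub_div, abs_div, abs_of_pos ht]
    gcongr
  have hθ : 0 ≤ θ := (abs_nonneg _).trans hd
  unfold Fz
  rw [← sub_div, ← sub_mul, abs_div, abs_mul, abs_of_pos h6, abs_of_pos ht]
  calc _ ≤ (lipC g (2 * M / ‖z‖ ^ s) * (θ / ‖z‖ ^ s)) * (Lam / ‖z‖ ^ n) / ‖z‖ ^ s := by
        gcongr
        exact h4.trans (by gcongr)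
    _ = _ := by unfold Cz; ring

theorem Hz_diff {n : ℕ} {s : ℝ} (hs0 : 0 < s) {g : ℝ → ℝ} {pg qg : ℝ} (hg : CondG g pg qg)
    {K : Eucl n → Eucl n → ℝ} {lam Lam : ℝ} (hK : CondK n K lam Lam) {v w : Eucl n → ℝ} {M : ℝ}
    (hv : ∀ x, |v x| ≤ M) (hw : ∀ x, |w x| ≤ M) {θ : ℝ} (x z : Eucl n)
    (hd : ∀ x y, |(v x - v y) - (w x - w y)| ≤ θ) :
    |Hz n s g K v x z - Hz n s g K w x z| ≤ θ * Cz n s g Lam M z := by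
  rcases eq_or_ne z 0 with rfl | hz1
  · rw [Hz_zero hs0, Hz_zero hs0]
    simp [Cz, Real.zero_rpow hs0.ne']
  have h1 := Fz_diff (s := s) hg hK hv hw x hz1 (hd _ _)
  have h2 := Fz_diff (s := s) hg hK hv hw x (neg_ne_zero.2 hz1) (hd _ _)
  have h3 : Cz n s g Lam M (-z) = Cz n s g Lam M z := by simp [Cz]
  rw [h3] at h2
  unfold Hz
  rw [← sub_div, add_sub_add_comm, abs_div, abs_two]
  have := abs_add_le (Fz n s g K v x z - Fz n s g K w x z)
    (Fz n s g K v x (-z) - Fz n s g K w x (-z))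
  linarith

theorem tendsto_D {n : ℕ} {s : ℝ} {g : ℝ → ℝ} {pg qg : ℝ} (hg : CondG g pg qg)
    {Lam M : ℝ} (hLam : 0 < Lam) (P : Eucl n → ℝ) (hP : Integrable P) (hP0 : ∀ z, 0 ≤ P z) :
    Tendsto (fun θ : ℝ => ∫ z, min (P z) (θ * Cz n s g Lam M z)) (𝓝[≥] 0) (𝓝 0) := by
  have hCm : Measurable (fun z => Cz n s g Lam M z) := by
    have := hg.continuous'.measurable
    unfold Cz lipC
    fun_prop
  have hC0 : ∀ z, 0 ≤ Cz n s g Lam M z := by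
    intro z
    have := hg.lipC_pos (2 * M / ‖z‖ ^ s)
    unfold Cz
    positivity
  rw [show 𝓝 (0:ℝ) = 𝓝 (∫ _ : Eucl n, (0:ℝ)) by simp]
  refine tendsto_integral_filter_of_dominated_convergence P ?_ ?_ hP ?_
  · refine Eventually.of_forall fun θ => ?_
    exact (hP.aestronglyMeasurable.aemeasurable.min
      (hCm.const_mul θ).aemeasurable).aestronglyMeasurable
  · filter_upwards [self_mem_nhdsWithin] with θ hθ
    refine Eventually.of_forall fun z => ?_
    rw [Real.norm_eq_abs, abs_of_nonneg (le_min (hP0 z) (mul_nonneg hθ (hC0 z)))]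
    exact min_le_left _ _
  · refine Eventually.of_forall fun z => ?_
    have : Tendsto (fun θ : ℝ => min (P z) (θ * Cz n s g Lam M z)) (𝓝 0)
        (𝓝 (min (P z) (0 * Cz n s g Lam M z))) :=
      Continuous.tendsto (f := fun θ : ℝ => min (P z) (θ * Cz n s g Lam M z)) (by fun_prop) 0
    rw [zero_mul, min_eq_right (hP0 z)] at this
    exact this.mono_left nhdsWithin_le_nhds

/-- Lemma 2.2: stability of `𝓛` under small `C²` bump
perturbations.  Here `p = p_g + 1`, and `sp/(p-1) = s(p_g+1)/p_g`. -/
theorem bump_stability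
    (n : ℕ) (hn : 1 ≤ n) (s : ℝ) (hs0 : 0 < s) (hs1 : s < 1)
    (g : ℝ → ℝ) (pg qg : ℝ) (hg : CondG g pg qg)
    (K : Eucl n → Eucl n → ℝ) (lam Lam : ℝ) (hK : CondK n K lam Lam)
    (Ω : Set (Eucl n)) (hΩo : IsOpen Ω) (hΩb : IsBounded Ω)
    (x₀ : Eucl n) (r : ℝ) (hr : 0 < r) (hball : ball x₀ r ⊆ Ω)
    (ψ : Eucl n → ℝ) (hψC2 : ContDiffOn ℝ 2 ψ (ball x₀ r))
    (hψbd : ∃ M : ℝ, ∀ x, |ψ x| ≤ M)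
    (hcase :
      (2 / (2 - s) < pg + 1 ∨ fderiv ℝ ψ x₀ ≠ 0) ∨
      (pg + 1 ≤ 2 / (2 - s) ∧ fderiv ℝ ψ x₀ = 0 ∧
        (∃ ε : ℝ, 0 < ε ∧ ∀ z ∈ ball x₀ ε, z ≠ x₀ → fderiv ℝ ψ z ≠ 0) ∧
        ∃ β : ℝ, s * (pg + 1) / pg < β ∧ C2beta n ψ (ball x₀ r) β)) :
    ∀ ε : ℝ, 0 < ε → ∀ ρ' : ℝ, 0 < ρ' →
      ∃ θ' : ℝ, 0 < θ' ∧ ∃ ρ : ℝ, 0 < ρ ∧ ρ < ρ' ∧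
        ∃ η : Eucl n → ℝ, ContDiff ℝ 2 η ∧ HasCompactSupport η ∧
          tsupport η ⊆ ball x₀ (ρ / 2) ∧ (∀ x, 0 ≤ η x ∧ η x ≤ 1) ∧ η x₀ = 1 ∧
          ∀ θ : ℝ, 0 ≤ θ → θ < θ' → ∀ x ∈ ball x₀ ρ,
            ∃ L Lθ : ℝ, Lpv n s g K ψ x L ∧
              Lpv n s g K (fun z => ψ z + θ * η z) x Lθ ∧ |L - Lθ| < ε := by
  intro ε hε ρ' hρ'
  obtain ⟨M, hM⟩ := hψbd
  have hM0 : 0 ≤ M := (abs_nonneg _).trans (hM 0)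
  have hLam : 0 < Lam := hK.lam_pos.trans_le hK.lam_le_Lam
  set ρ := min ρ' r / 4 with hρ
  have hm : 0 < min ρ' r := lt_min hρ' hr
  have hρ0 : 0 < ρ := by positivity
  have hρ1 : ρ < ρ' := by
    have := min_le_left ρ' r; linarith
  have hρr : ρ ≤ r / 4 := by
    have := min_le_right ρ' r; linarith
  let f : ContDiffBump x₀ := ⟨ρ / 8, ρ / 4, by positivity, by linarith⟩
  have hfC : ContDiff ℝ 2 (f : Eucl n → ℝ) := f.contDiff
  obtain ⟨C1, hC1, hb1⟩ := c2_bounds n ψ x₀ r hr hψC2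
  obtain ⟨C2, hC2, hb2⟩ := c2_bounds n f x₀ r hr hfC.contDiffOn
  set C := C1 + C2 with hC
  have hδ : 0 < r / 4 := by positivity
  set B := (lipC g (C * (r / 4) ^ (1 - s)) * C + g (2 * (M + 1) / (r / 4) ^ s)) * Lam with hB
  have hB0 : 0 ≤ B := by
    have hL := hg.lipC_pos (C * (r / 4) ^ (1 - s))
    have hgM : 0 ≤ g (2 * (M + 1) / (r / 4) ^ s) := by
      rw [← hg.zero]; exact hg.strictMono'.monotone (by positivity)
    positivity
  have hprof := integrable_prof n hn s hs0 hs1 (r / 4) hδ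
  have hT := tendsto_D (n := n) (s := s) hg (M := M + 1) hLam
    (fun z => 2 * (B * prof n s (r / 4) ‖z‖)) ((hprof.const_mul B).const_mul 2)
    (fun z => by have := prof_nonneg n s (r / 4) (norm_nonneg z); positivity)
  have hev := hT.eventually (Iio_mem_nhds hε)
  obtain ⟨θ₁, hθ₁, hsub⟩ := mem_nhdsGE_iff_exists_Ico_subset.1 hev
  have hθ₁ : 0 < θ₁ := hθ₁
  refine ⟨min θ₁ 1, by positivity, ρ, hρ0, hρ1, f, hfC, f.hasCompactSupport, ?_, ?_, ?_, ?_⟩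
  · rw [f.tsupport_eq]
    exact closedBall_subset_ball (by change ρ / 4 < ρ / 2; linarith)
  · exact fun x => ⟨f.nonneg, f.le_one⟩
  · exact f.one_of_mem_closedBall (by simp [f.rIn_pos.le])
  intro θ hθ0 hθ x hx
  have hθ1 : θ < 1 := hθ.trans_le (min_le_right _ _)
  have hθ2 : θ < θ₁ := hθ.trans_le (min_le_left _ _)
  have hx4 : x ∈ ball x₀ (r / 4) := ball_subset_ball hρr hx
  set w : Eucl n → ℝ := fun z => ψ z + θ * f z with hw
  by_cases hmeas : AEMeasurable ψ
  swap
  · refine ⟨0, 0, ?_, ?_, by simpa using hε⟩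
    · exact Lpv_of_not_meas hg hK hmeas hψC2.continuousOn (ball_subset_ball (by linarith) hx4)
    · refine Lpv_of_not_meas hg hK ?_ (x₀ := x₀) (r := r) ?_ (ball_subset_ball (by linarith) hx4)
      · intro h
        apply hmeas
        have h1 : Measurable (fun z => θ * f z) := (hfC.continuous.measurable).const_mul θ
        refine (h.sub h1.aemeasurable).congr (Eventually.of_forall fun z => ?_)
        simp [hw]
      · exact hψC2.continuousOn.add (continuous_const.mul hfC.continuous).continuousOn
  have hwm : AEMeasurable w := hmeas.add ((hfC.continuous.measurable).const_mul θ).aemeasurable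
  have hψM : ∀ y, |ψ y| ≤ M + 1 := fun y => (hM y).trans (by linarith)
  have hfb : ∀ y, 0 ≤ θ * f y ∧ θ * f y ≤ θ := fun y =>
    ⟨mul_nonneg hθ0 f.nonneg, mul_le_of_le_one_right hθ0 f.le_one⟩
  have hwM : ∀ y, |w y| ≤ M + 1 := by
    intro y
    have h1 := hM y
    have h2 := hfb y
    rw [abs_le] at h1 ⊢
    simp only [hw]
    constructor <;> linarith
  have hψH : ∀ z, |Hz n s g K ψ x z| ≤ B * prof n s (r / 4) ‖z‖ := by
    refine Hz_bound hs0 hs1 hg hK (by positivity) hψM hδ ?_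
    intro z hz
    obtain ⟨h1, h2⟩ := hb1 x hx4 z hz
    exact ⟨h1.trans (by gcongr; linarith), h2.trans (by gcongr; linarith)⟩
  have hwH : ∀ z, |Hz n s g K w x z| ≤ B * prof n s (r / 4) ‖z‖ := by
    refine Hz_bound hs0 hs1 hg hK (by positivity) hwM hδ ?_
    intro z hz
    obtain ⟨h1, h2⟩ := hb1 x hx4 z hz
    obtain ⟨h3, h4⟩ := hb2 x hx4 z hz
    have aux : ∀ a b c d : ℝ, |a| ≤ c → |b| ≤ d → |a + θ * b| ≤ c + d := by
      intro a b c d h h'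
      have := abs_add_le a (θ * b)
      rw [abs_mul, abs_of_nonneg hθ0] at this
      have : θ * |b| ≤ |b| := mul_le_of_le_one_left (abs_nonneg b) hθ1.le
      linarith
    constructor
    · have := aux _ _ _ _ h1 h3
      rw [← add_mul] at this
      refine le_trans (le_of_eq ?_) this
      simp only [hw]; congr 1; ring
    · have := aux _ _ _ _ h2 h4
      rw [← add_mul] at this
      refine le_trans (le_of_eq ?_) this
      simp only [hw]; congr 1; ring
  have hψI : Integrable (fun z => Hz n s g K ψ x z) :=
    (hprof.const_mul B).mono' (Hz_meas hg hK hmeas x).aestronglyMeasurable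
      (Eventually.of_forall hψH)
  have hwI : Integrable (fun z => Hz n s g K w x z) :=
    (hprof.const_mul B).mono' (Hz_meas hg hK hwm x).aestronglyMeasurable
      (Eventually.of_forall hwH)
  refine ⟨_, _, Lpv_of_meas hn hs0 hs1 hg hK hmeas hψM x hψI,
    Lpv_of_meas hn hs0 hs1 hg hK hwm hwM x hwI, ?_⟩
  have hlt : ∫ z, min (2 * (B * prof n s (r / 4) ‖z‖)) (θ * Cz n s g Lam (M + 1) z) < ε :=
    hsub ⟨hθ0, hθ2⟩
  refine lt_of_le_of_lt ?_ hlt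
  rw [← integral_sub hψI hwI]
  have hpt : ∀ z, |Hz n s g K ψ x z - Hz n s g K w x z| ≤
      min (2 * (B * prof n s (r / 4) ‖z‖)) (θ * Cz n s g Lam (M + 1) z) := by
    intro z
    refine le_min ?_ ?_
    · have := abs_sub (Hz n s g K ψ x z) (Hz n s g K w x z)
      linarith [hψH z, hwH z]
    · refine Hz_diff hs0 hg hK hψM hwM x z ?_
      intro a b
      have h1 := hfb a
      have h2 := hfb b
      simp only [hw]
      rw [abs_le]
      constructor <;> linarith
  have hDI : Integrable (fun z => min (2 * (B * prof n s (r / 4) ‖z‖))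
      (θ * Cz n s g Lam (M + 1) z)) := by
    have hCm : Measurable (fun z => Cz n s g Lam (M + 1) z) := by
      have := hg.continuous'.measurable
      unfold Cz lipC
      fun_prop
    refine ((hprof.const_mul B).const_mul 2).mono' (((hprof.const_mul B).const_mul
      2).aestronglyMeasurable.aemeasurable.min
      (hCm.const_mul θ).aemeasurable).aestronglyMeasurable (Eventually.of_forall fun z => ?_)
    rw [Real.norm_eq_abs, abs_of_nonneg ((abs_nonneg _).trans (hpt z))]
    exact min_le_left _ _
  rw [← Real.norm_eq_abs]
  refine norm_integral_le_of_norm_le hDI (Eventually.of_forall fun z => ?_)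
  rw [Real.norm_eq_abs]
  exact hpt z
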